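/- (Covering number estimate.) Let m ≥ 1, a ≥ 1, and let G_n = {g_1, …, g_n} be a set of n functions on X with ‖g_j‖_∞ ≤ 1 and n ≤ m^a. For k ≥ 1 let F_k be the union, over all subsets Λ ⊆ G_n of cardinality at most k, of {πf : f ∈ span Λ}. Then for every 0 < ε ≤ 1 and every choice of points x_1, …, x_m ∈ X: N₁(ε, F_k, x_1^m) ≤ 3·m^{ak}·( (2e/ε)·log(3e/ε) )^{k+1}. -/

import Mathlib

/-- The `ℓ¹` empirical covering number `N₁(ε, F, x₁^m)`: the smallest `N` for which there
exist functions `f₁, …, f_N` such that every `f ∈ F` is within empirical `ℓ¹` distance `ε`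
of some `f_j`. -/
noncomputable def covN {α : Type*} {m : ℕ} (ε : ℝ) (F : Set (α → ℝ)) (x : Fin m → α) : ℕ :=
  sInf {N : ℕ | ∃ c : Fin N → α → ℝ, ∀ f ∈ F, ∃ j : Fin N,
    (1 / (m : ℝ)) * ∑ i, |f (x i) - c j (x i)| ≤ ε}

/-- Truncation `π(t) = min{1,|t|}·sgn(t)` of `t ∈ ℝ` to `[-1, 1]`. -/
noncomputable def trunc (t : ℝ) : ℝ := max (-1) (min 1 t)

/-- The hypothesis space `F_k`: truncations of functions in the span of at most `k`
dictionary elements. -/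
def hypSpace {X : Type*} {n : ℕ} (g : Fin n → X → ℝ) (k : ℕ) : Set (X → ℝ) :=
  {f | ∃ Λ : Finset (Fin n), Λ.card ≤ k ∧ ∃ β : Fin n → ℝ,
    (∀ j ∉ Λ, β j = 0) ∧ f = fun t => trunc (∑ j, β j * g j t)}


lemma aux_annih {n K : ℕ} (Λ : Finset (Fin n)) (G : Fin n → Fin K → ℝ) (S : Finset (Fin K))
    (hS : Λ.card < S.card) :
    ∃ c : Fin K → ℝ, (∀ i ∉ S, c i = 0) ∧ (∃ i, 0 < c i) ∧ ∀ j ∈ Λ, ∑ i, c i * G j i = 0 := by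
  let φ : (S → ℝ) →ₗ[ℝ] (Λ → ℝ) :=
    LinearMap.pi fun j => ∑ i : S, (G j i) • LinearMap.proj i
  have hker : LinearMap.ker φ ≠ ⊥ := by
    apply LinearMap.ker_ne_bot_of_finrank_lt
    simpa using hS
  obtain ⟨v, hv, hv0⟩ := Submodule.exists_mem_ne_zero_of_ne_bot hker
  have key : ∀ j ∈ Λ, ∑ i : S, v i * G j i = 0 := by
    intro j hj
    have := congrFun (LinearMap.mem_ker.1 hv) ⟨j, hj⟩
    simpa [φ, mul_comm] using this
  let c : Fin K → ℝ := fun i => if h : i ∈ S then v ⟨i, h⟩ else 0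
  have hc0 : ∀ i ∉ S, c i = 0 := fun i hi => by simp [c, hi]
  have hcs : ∀ j ∈ Λ, ∑ i, c i * G j i = 0 := by
    intro j hj
    rw [← key j hj, ← Finset.sum_subset (Finset.subset_univ S), ← Finset.sum_coe_sort S]
    · refine Finset.sum_congr rfl fun i _ => ?_
      simp [c]
    · intro i _ hi
      simp [hc0 i hi]
  obtain ⟨i, hi⟩ := Function.ne_iff.1 hv0
  have hci : c i = v i := by simp [c]
  rcases lt_or_gt_of_ne hi with h | h
  · refine ⟨fun i => - c i, fun i hi => by simp [hc0 i hi], ⟨i, ?_⟩, fun j hj => ?_⟩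
    · change 0 < - c i
      rw [hci]; simpa using h
    · simp [Finset.sum_neg_distrib, hcs j hj]
  · exact ⟨c, hc0, ⟨i, by rw [hci]; simpa using h⟩, hcs⟩

lemma aux_sauer {n K : ℕ} (Λ : Finset (Fin n)) (G : Fin n → Fin K → ℝ) (h : Fin K → ℝ)
    (A : Finset (Finset (Fin K)))
    (hA : ∀ s ∈ A, ∃ β : Fin n → ℝ, (∀ j ∉ Λ, β j = 0) ∧
      ∀ i, i ∈ s ↔ h i < ∑ j, β j * G j i) :
    A.card ≤ ∑ i ∈ Finset.range (Λ.card + 1), K.choose i := by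
  have hvc : A.vcDim ≤ Λ.card := by
    unfold Finset.vcDim
    refine Finset.sup_le fun S hS => ?_
    rw [Finset.mem_shatterer] at hS
    by_contra hlt
    push Not at hlt
    obtain ⟨c, hc0, ⟨i0, hi0⟩, hc⟩ := aux_annih Λ G S hlt
    have hi0S : i0 ∈ S := by
      by_contra hh
      rw [hc0 i0 hh] at hi0
      exact lt_irrefl _ hi0
    have hz : ∀ β : Fin n → ℝ, (∀ j ∉ Λ, β j = 0) → ∑ i, c i * ∑ j, β j * G j i = 0 := by
      intro β hβ
      simp_rw [Finset.mul_sum]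
      rw [Finset.sum_comm]
      refine Finset.sum_eq_zero fun j _ => ?_
      by_cases hj : j ∈ Λ
      · have : ∑ i, c i * (β j * G j i) = β j * ∑ i, c i * G j i := by
          rw [Finset.mul_sum]; exact Finset.sum_congr rfl fun i _ => by ring
        rw [this, hc j hj, mul_zero]
      · simp [hβ j hj]
    have h1 : ∑ i, c i * h i < 0 := by
      obtain ⟨s, hs, hs'⟩ := hS (Finset.filter_subset (fun i => 0 < c i) S)
      obtain ⟨β, hβ, hi⟩ := hA s hs
      rw [← hz β hβ]
      have hmem : ∀ i ∈ S, (i ∈ s ↔ 0 < c i) := by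
        intro i hiS
        have := Finset.ext_iff.1 hs' i
        simp [hiS] at this
        exact this
      refine Finset.sum_lt_sum (fun i _ => ?_) ⟨i0, Finset.mem_univ _, ?_⟩
      · by_cases hiS : i ∈ S
        · by_cases hp : 0 < c i
          · exact mul_le_mul_of_nonneg_left ((hi i).1 ((hmem i hiS).2 hp)).le hp.le
          · have : ¬ h i < _ := fun hh => hp ((hmem i hiS).1 ((hi i).2 hh))
            exact mul_le_mul_of_nonpos_left (not_lt.1 this) (not_lt.1 hp)
        · simp [hc0 i hiS]
      · exact mul_lt_mul_of_pos_left ((hi i0).1 ((hmem i0 hi0S).2 hi0)) hi0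
    have h2 : 0 ≤ ∑ i, c i * h i := by
      obtain ⟨s, hs, hs'⟩ := hS (Finset.filter_subset (fun i => c i < 0) S)
      obtain ⟨β, hβ, hi⟩ := hA s hs
      rw [← hz β hβ]
      have hmem : ∀ i ∈ S, (i ∈ s ↔ c i < 0) := by
        intro i hiS
        have := Finset.ext_iff.1 hs' i
        simp [hiS] at this
        exact this
      refine Finset.sum_le_sum (fun i _ => ?_)
      by_cases hiS : i ∈ S
      · by_cases hp : c i < 0
        · exact mul_le_mul_of_nonpos_left ((hi i).1 ((hmem i hiS).2 hp)).le hp.le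
        · have : ¬ h i < _ := fun hh => hp ((hmem i hiS).1 ((hi i).2 hh))
          exact mul_le_mul_of_nonneg_left (not_lt.1 this) (not_lt.1 hp)
      · simp [hc0 i hiS]
    exact absurd h1 (not_lt.2 h2)
  calc A.card ≤ A.shatterer.card := Finset.card_le_card_shatterer A
    _ ≤ ∑ k ∈ Finset.Iic A.vcDim, (Fintype.card (Fin K)).choose k :=
      Finset.card_shatterer_le_sum_vcDim
    _ ≤ ∑ i ∈ Finset.range (Λ.card + 1), K.choose i := by
      rw [Fintype.card_fin]
      refine Finset.sum_le_sum_of_subset fun i hi => ?_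
      simp at hi ⊢
      omega

lemma aux_binom (K d : ℕ) (hd : 1 ≤ d) (hK : d ≤ K) :
    ((∑ i ∈ Finset.range (d + 1), K.choose i : ℕ) : ℝ) ≤ (Real.exp 1 * K / d) ^ d := by
  have hd' : (0:ℝ) < d := by exact_mod_cast hd
  have hK' : (0:ℝ) < K := by exact_mod_cast (lt_of_lt_of_le hd hK)
  have hdK : (d:ℝ) ≤ K := by exact_mod_cast hK
  have hr : (1:ℝ) ≤ K / d := by rwa [one_le_div hd']
  calc ((∑ i ∈ Finset.range (d + 1), K.choose i : ℕ) : ℝ)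
      = ∑ i ∈ Finset.range (d + 1), (K.choose i : ℝ) := by push_cast; rfl
    _ ≤ ∑ i ∈ Finset.range (d + 1), (K / d : ℝ) ^ d * ((d / K : ℝ) ^ i * K.choose i) := by
        refine Finset.sum_le_sum fun i hi => ?_
        have hi' : i ≤ d := by simp at hi; omega
        have h1 : (1:ℝ) ≤ (K / d : ℝ) ^ d * (d / K : ℝ) ^ i := by
          have : (d / K : ℝ) ^ i = ((K / d : ℝ) ^ i)⁻¹ := by rw [← inv_pow, inv_div]
          rw [this, ← div_eq_mul_inv, one_le_div (by positivity)]
          exact pow_le_pow_right₀ hr hi'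
        rw [← mul_assoc]
        exact le_mul_of_one_le_left (by positivity) h1
    _ ≤ ∑ i ∈ Finset.range (K + 1), (K / d : ℝ) ^ d * ((d / K : ℝ) ^ i * K.choose i) := by
        refine Finset.sum_le_sum_of_subset_of_nonneg ?_ fun i _ _ => by positivity
        intro i hi; simp at hi ⊢; omega
    _ = (K / d : ℝ) ^ d * (d / K + 1) ^ K := by
        rw [← Finset.mul_sum, add_pow]
        simp
    _ ≤ (K / d : ℝ) ^ d * (Real.exp (d / K)) ^ K := by
        gcongr
        exact Real.add_one_le_exp _
    _ = (Real.exp 1 * K / d) ^ d := by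
        rw [← Real.exp_nat_mul, mul_div_cancel₀ _ hK'.ne', mul_div_assoc, mul_pow, ← Real.exp_nat_mul]
        ring_nf

open Classical in
lemma aux_greedy {τ Ω : Type*} [Fintype Ω] [Nonempty Ω] (s : τ → Ω → Prop)
    (P : Finset (τ × τ)) (δ : ℝ) (hδ : δ ≤ 1)
    (hP : ∀ p ∈ P, δ * Fintype.card Ω ≤
      ((Finset.univ.filter fun ω => ¬ (s p.1 ω ↔ s p.2 ω)).card : ℝ)) (K : ℕ) :
    ∃ w : Fin K → Ω,
      ((P.filter fun p => ∀ i, (s p.1 (w i) ↔ s p.2 (w i))).card : ℝ) ≤ P.card * (1 - δ) ^ K := by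
  induction K with
  | zero => exact ⟨Fin.elim0, by simp⟩
  | succ K ih =>
    obtain ⟨w, hw⟩ := ih
    set R := P.filter fun p => ∀ i, (s p.1 (w i) ↔ s p.2 (w i)) with hR
    have hΩ : (0:ℝ) < Fintype.card Ω := by exact_mod_cast Fintype.card_pos
    have hex : ∃ ω, ((R.filter fun p => (s p.1 ω ↔ s p.2 ω)).card : ℝ) ≤ R.card * (1 - δ) := by
      by_contra hcon
      push Not at hcon
      have h1 : (Fintype.card Ω : ℝ) * (R.card * (1 - δ)) <
          ∑ ω : Ω, ((R.filter fun p => (s p.1 ω ↔ s p.2 ω)).card : ℝ) := by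
        have := Finset.sum_lt_sum_of_nonempty (Finset.univ_nonempty (α := Ω))
          (fun ω _ => hcon ω)
        simpa using this
      have h2 : ∑ ω : Ω, ((R.filter fun p => (s p.1 ω ↔ s p.2 ω)).card : ℝ) =
          ∑ p ∈ R, ((Finset.univ.filter fun ω => (s p.1 ω ↔ s p.2 ω)).card : ℝ) := by
        simp only [Finset.card_filter]
        push_cast
        rw [Finset.sum_comm]
      have h3 : ∑ p ∈ R, ((Finset.univ.filter fun ω => (s p.1 ω ↔ s p.2 ω)).card : ℝ) ≤
          ∑ p ∈ R, (1 - δ) * (Fintype.card Ω : ℝ) := by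
        refine Finset.sum_le_sum fun p hp => ?_
        have := hP p (Finset.mem_of_mem_filter p hp)
        have h4 := Finset.card_filter_add_card_filter_not (s := (Finset.univ : Finset Ω))
          (fun ω => (s p.1 ω ↔ s p.2 ω))
        rw [Finset.card_univ] at h4
        have h5 : ((Finset.univ.filter fun ω => (s p.1 ω ↔ s p.2 ω)).card : ℝ) +
          ((Finset.univ.filter fun ω => ¬ (s p.1 ω ↔ s p.2 ω)).card : ℝ) = Fintype.card Ω := by
          exact_mod_cast h4
        linarith
      rw [h2] at h1
      simp only [Finset.sum_const, nsmul_eq_mul] at h3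
      nlinarith
    obtain ⟨ω, hω⟩ := hex
    refine ⟨Fin.cons ω w, ?_⟩
    have : (P.filter fun p => ∀ i : Fin (K+1), (s p.1 ((Fin.cons ω w : Fin (K+1) → Ω) i) ↔
        s p.2 ((Fin.cons ω w : Fin (K+1) → Ω) i))) =
        R.filter fun p => (s p.1 ω ↔ s p.2 ω) := by
      ext p
      simp [hR, Fin.forall_fin_succ]
      tauto
    rw [this]
    calc _ ≤ R.card * (1 - δ) := hω
      _ ≤ (P.card * (1 - δ) ^ K) * (1 - δ) := by
        apply mul_le_mul_of_nonneg_right hw; linarith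
      _ = _ := by ring

lemma aux_count (Q : ℕ) (hQ : 1 ≤ Q) (u v : ℝ) (hu : |u| ≤ 1) (hv : |v| ≤ 1) :
    Q * |u - v| / 2 - 1 ≤ ((Finset.univ.filter fun q : Fin Q =>
      ¬ ((-1 + 2 * (q : ℝ) / Q < u) ↔ (-1 + 2 * (q : ℝ) / Q < v))).card : ℝ) := by
  wlog h : v ≤ u generalizing u v
  · have := this v u hv hu (le_of_not_ge h)
    rw [abs_sub_comm]
    refine this.trans (le_of_eq ?_)
    congr 2
    ext q
    simp only [Finset.mem_filter]
    tauto
  rw [abs_of_nonneg (sub_nonneg.2 h)]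
  rw [abs_le] at hu hv
  have hQ' : (0:ℝ) < Q := by exact_mod_cast hQ
  set a := ⌈(Q:ℝ) * (v + 1) / 2⌉₊
  set b := ⌈(Q:ℝ) * (u + 1) / 2⌉₊
  have hb : b ≤ Q := by
    apply Nat.ceil_le.2
    nlinarith
  have hb' : (Q:ℝ) * (u + 1) / 2 ≤ b := Nat.le_ceil _
  have ha' : (a:ℝ) < (Q:ℝ) * (v + 1) / 2 + 1 := Nat.ceil_lt_add_one (by
    have : 0 ≤ v + 1 := by linarith
    positivity)
  have hthr : ∀ (q : ℕ) (z : ℝ), (-1 + 2 * (q : ℝ) / Q < z) ↔ q < ⌈(Q:ℝ) * (z + 1) / 2⌉₊ := by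
    intro q z
    rw [Nat.lt_ceil, ← sub_pos, ← sub_pos (b := (q:ℝ))]
    have : (Q:ℝ) * (z + 1) / 2 - q = (z - (-1 + 2 * (q:ℝ) / Q)) * (Q / 2) := by
      field_simp; ring
    rw [this]
    constructor
    · intro h; positivity
    · intro h; exact pos_of_mul_pos_left h (by positivity)
  have hcard : (Finset.Ico a b).card ≤ (Finset.univ.filter fun q : Fin Q =>
      ¬ ((-1 + 2 * (q : ℝ) / Q < u) ↔ (-1 + 2 * (q : ℝ) / Q < v))).card := by
    rw [← Finset.card_map Fin.valEmbedding]
    apply Finset.card_le_card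
    intro q hq
    rw [Finset.mem_Ico] at hq
    rw [Finset.mem_map]
    refine ⟨⟨q, lt_of_lt_of_le hq.2 hb⟩, ?_, rfl⟩
    simp only [Finset.mem_filter, Finset.mem_univ, true_and]
    rw [hthr, hthr]
    change ¬ (q < b ↔ q < a)
    omega
  rw [Nat.card_Ico] at hcard
  have h3 : (b:ℝ) ≤ ((b - a : ℕ) : ℝ) + a := by
    exact_mod_cast (by omega : b ≤ (b - a) + a)
  have h4 : ((b - a : ℕ) : ℝ) ≤ _ := Nat.cast_le.2 hcard
  linarith

/-- truncated span of a fixed sub-dictionary -/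
def auxSpan {X : Type*} {n : ℕ} (g : Fin n → X → ℝ) (Λ : Finset (Fin n)) : Set (X → ℝ) :=
  {f | ∃ β : Fin n → ℝ, (∀ j ∉ Λ, β j = 0) ∧ f = fun t => trunc (∑ j, β j * g j t)}

lemma aux_trunc_abs (t : ℝ) : |trunc t| ≤ 1 := by
  unfold trunc
  rw [abs_le]
  exact ⟨le_max_left _ _, max_le (by norm_num) (min_le_left _ _)⟩

lemma aux_trunc_lt (s t : ℝ) (h1 : -1 ≤ s) (h2 : s < 1) : s < trunc t ↔ s < t := by
  unfold trunc
  rw [lt_max_iff, lt_min_iff]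
  constructor
  · rintro (h | h)
    · linarith
    · exact h.2
  · intro h
    exact Or.inr ⟨h2, h⟩

lemma aux_numeric (ε : ℝ) (hε0 : 0 < ε) (hε1 : ε ≤ 1) (L : ℝ)
    (hL : L = (2 * Real.exp 1 / ε) * Real.log (3 * Real.exp 1 / ε)) :
    9 ≤ L ∧ Real.exp 1 / ε * (4 * Real.log (5 * L) + 3) ≤ 5 * L := by
  have he := Real.exp_one_gt_d9
  set l := Real.log (3 * Real.exp 1 / ε) with hl
  have hl2 : 2 ≤ l := by
    rw [hl, Real.le_log_iff_exp_le (by positivity)]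
    have h2 : Real.exp 2 = Real.exp 1 * Real.exp 1 := by rw [← Real.exp_add]; norm_num
    have h3 := Real.exp_one_lt_d9
    rw [h2, le_div_iff₀ hε0]
    have : Real.exp 1 * Real.exp 1 * ε ≤ Real.exp 1 * Real.exp 1 * 1 := by gcongr
    nlinarith
  have hlpos : 0 < l := by linarith
  have hinv : 1 ≤ 1 / ε := by rw [le_div_iff₀ hε0]; linarith
  have hL9 : 9 ≤ L := by
    have : 2 * Real.exp 1 / ε = 2 * Real.exp 1 * (1 / ε) := by ring
    rw [hL, this]
    have : 5 ≤ 2 * Real.exp 1 * (1 / ε) := by nlinarith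
    nlinarith
  refine ⟨hL9, ?_⟩
  have hlog : Real.log (5 * L) = Real.log (10 / 3) + l + Real.log l := by
    have : 5 * L = (10 / 3) * (3 * Real.exp 1 / ε) * l := by rw [hL]; ring
    rw [this, Real.log_mul (by positivity) hlpos.ne', Real.log_mul (by positivity) (by positivity)]
  have h103 : Real.log (10 / 3) ≤ 1.25 := by
    rw [Real.log_le_iff_le_exp (by norm_num)]
    have h5 : Real.exp 1.25 ^ 4 = Real.exp 1 ^ 5 := by
      rw [← Real.exp_nat_mul, ← Real.exp_nat_mul]; norm_num
    have h6 : (2.7:ℝ) ^ 5 ≤ Real.exp 1 ^ 5 := by gcongr; linarith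
    refine le_of_pow_le_pow_left₀ (n := 4) (by norm_num) (by positivity) ?_
    rw [h5]
    refine le_trans ?_ h6
    norm_num
  have hll : Real.log l ≤ l - 1 := Real.log_le_sub_one_of_pos hlpos
  have : 5 * L = Real.exp 1 / ε * (10 * l) := by rw [hL]; ring
  refine le_trans ?_ this.ge
  apply mul_le_mul_of_nonneg_left _ (by positivity)
  rw [hlog]
  linarith

lemma aux_packing {X : Type*} (m n : ℕ) (hm : 1 ≤ m) (g : Fin n → X → ℝ)
    (Λ : Finset (Fin n)) (hd : 1 ≤ Λ.card)
    (ε : ℝ) (hε0 : 0 < ε) (hε1 : ε ≤ 1) (x : Fin m → X) (y : ℝ) (hy : 1 ≤ y)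
    (hy2 : Real.exp 1 / ε * (4 * Real.log y + 3) ≤ y)
    (T : Finset (X → ℝ)) (hT : ∀ f ∈ T, f ∈ auxSpan g Λ)
    (hsep : ∀ f ∈ T, ∀ f' ∈ T, f ≠ f' → ε < (1 / (m : ℝ)) * ∑ i, |f (x i) - f' (x i)|) :
    (T.card : ℝ) ≤ y ^ Λ.card := by
  classical
  by_contra hcon
  push Not at hcon
  set d := Λ.card with hdd
  have hy0 : 0 < y := by linarith
  have hm' : (0:ℝ) < m := by exact_mod_cast hm
  have hd1 : (1:ℝ) ≤ d := by exact_mod_cast hd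
  have hlogy : 0 ≤ Real.log y := Real.log_nonneg hy
  have hfl : ⌊y ^ d⌋₊ + 1 ≤ T.card := Nat.succ_le_of_lt ((Nat.floor_lt (by positivity)).2 hcon)
  obtain ⟨T', hT'T, hT'c⟩ := Finset.exists_subset_card_eq hfl
  have hMgt : y ^ d < T'.card := by rw [hT'c]; push_cast; exact Nat.lt_floor_add_one _
  have hMle : (T'.card : ℝ) ≤ y ^ d + 1 := by
    rw [hT'c]; push_cast
    have := Nat.floor_le (by positivity : 0 ≤ y ^ d)
    linarith
  -- discretisation level
  obtain ⟨Q, hQ1, hQ⟩ : ∃ Q : ℕ, 1 ≤ Q ∧ ∀ p ∈ T'.offDiag,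
      1 / (Q : ℝ) ≤ ((1 / (m : ℝ)) * ∑ i, |p.1 (x i) - p.2 (x i)| - ε) / 2 := by
    have hev : ∀ᶠ Q : ℕ in Filter.atTop, ∀ p ∈ T'.offDiag,
        1 / (Q : ℝ) ≤ ((1 / (m : ℝ)) * ∑ i, |p.1 (x i) - p.2 (x i)| - ε) / 2 := by
      rw [Filter.eventually_all_finset]
      intro p hp
      rw [Finset.mem_offDiag] at hp
      have h0 := hsep p.1 (hT'T hp.1) p.2 (hT'T hp.2.1) hp.2.2
      exact (tendsto_one_div_atTop_nhds_zero_nat (𝕜 := ℝ)).eventually_le_const (by linarith)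
    obtain ⟨Q, h1, h2⟩ := (hev.and (Filter.eventually_ge_atTop 1)).exists
    exact ⟨Q, h2, h1⟩
  have hQ' : (0:ℝ) < Q := by exact_mod_cast hQ1
  have : Nonempty (Fin m × Fin Q) := ⟨(⟨0, hm⟩, ⟨0, hQ1⟩)⟩
  let thr : Fin Q → ℝ := fun q => -1 + 2 * ((q : ℕ) : ℝ) / Q
  let s : (X → ℝ) → Fin m × Fin Q → Prop := fun f ω => thr ω.2 < f (x ω.1)
  have habs : ∀ f ∈ T', ∀ t, |f t| ≤ 1 := by
    intro f hf t
    obtain ⟨β, -, rfl⟩ := hT f (hT'T hf)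
    exact aux_trunc_abs _
  have hP : ∀ p ∈ T'.offDiag, (ε / 2) * Fintype.card (Fin m × Fin Q) ≤
      ((Finset.univ.filter fun ω => ¬ (s p.1 ω ↔ s p.2 ω)).card : ℝ) := by
    intro p hp
    have h1 := hQ p hp
    rw [Finset.mem_offDiag] at hp
    have h2 : ((Finset.univ.filter fun ω => ¬ (s p.1 ω ↔ s p.2 ω)).card : ℝ) =
        ∑ i : Fin m, ((Finset.univ.filter fun q : Fin Q =>
          ¬ ((-1 + 2 * (q : ℝ) / Q < p.1 (x i)) ↔ (-1 + 2 * (q : ℝ) / Q < p.2 (x i)))).card : ℝ) := by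
      simp only [Finset.card_filter]
      push_cast
      rw [← Finset.univ_product_univ, Finset.sum_product]
    rw [h2]
    have h3 : ∑ i : Fin m, ((Q:ℝ) * |p.1 (x i) - p.2 (x i)| / 2 - 1) ≤ _ :=
      Finset.sum_le_sum fun i _ => aux_count Q hQ1 (p.1 (x i)) (p.2 (x i))
        (habs _ hp.1 _) (habs _ hp.2.1 _)
    refine le_trans ?_ h3
    rw [Finset.sum_sub_distrib, ← Finset.sum_div, ← Finset.mul_sum]
    simp only [Fintype.card_prod, Fintype.card_fin, Finset.sum_const, Finset.card_univ,
      nsmul_eq_mul, mul_one]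
    push_cast
    set D := ∑ i, |p.1 (x i) - p.2 (x i)|
    have h4 := mul_le_mul_of_nonneg_left h1 (by positivity : (0:ℝ) ≤ m * Q)
    have h5 : (m:ℝ) * Q * (1 / Q) = m := by field_simp
    have h6 : (m:ℝ) * Q * ((1 / (m:ℝ) * D - ε) / 2) = Q * D / 2 - ε / 2 * (m * Q) := by
      field_simp
    linarith
  set K := ⌈(d / ε) * (4 * Real.log y + 2)⌉₊ with hKdef
  have hK1 : (d / ε) * (4 * Real.log y + 2) ≤ K := Nat.le_ceil _
  have hde : (1:ℝ) ≤ d / ε := by rw [le_div_iff₀ hε0]; linarith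
  have hdd' : (d:ℝ) ≤ d / ε := by rw [le_div_iff₀ hε0]; nlinarith
  have hK2 : (K:ℝ) ≤ (d / ε) * (4 * Real.log y + 3) := by
    have := Nat.ceil_lt_add_one (by positivity : 0 ≤ (d / ε) * (4 * Real.log y + 2))
    rw [← hKdef] at this
    nlinarith
  have hdK : d ≤ K := by
    have : (d:ℝ) ≤ K := by nlinarith
    exact_mod_cast this
  obtain ⟨w, hw⟩ := aux_greedy s T'.offDiag (ε / 2) (by linarith) hP K
  have hlt : (T'.offDiag.card : ℝ) * (1 - ε / 2) ^ K < 1 := by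
    have hc1 : (T'.offDiag.card : ℝ) ≤ 2 * (y ^ d) ^ 2 := by
      rw [Finset.offDiag_card]
      have h1 : 1 ≤ y ^ d := one_le_pow₀ hy
      rw [Nat.cast_sub (Nat.le_mul_self _)]
      push_cast
      nlinarith
    have hc2 : (1 - ε / 2) ^ K ≤ Real.exp (-(2 * Real.log y * d) - d) := by
      calc (1 - ε / 2) ^ K ≤ (Real.exp (-(ε / 2))) ^ K := by
            apply pow_le_pow_left₀ (by linarith)
            exact Real.one_sub_le_exp_neg _
        _ = Real.exp (K * (-(ε / 2))) := by rw [← Real.exp_nat_mul]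
        _ ≤ _ := by
            apply Real.exp_le_exp.2
            have h7 := mul_le_mul_of_nonneg_right hK1 (by positivity : 0 ≤ ε / 2)
            have h8 : (d / ε) * (4 * Real.log y + 2) * (ε / 2) = 2 * Real.log y * d + d := by
              field_simp; ring
            linarith
    have hc3 : Real.exp (-(2 * Real.log y * d) - d) = ((y ^ d) ^ 2)⁻¹ * Real.exp (-d) := by
      rw [sub_eq_add_neg, Real.exp_add, Real.exp_neg]
      congr 2
      rw [← pow_mul, ← Real.exp_log hy0, ← Real.exp_nat_mul, Real.log_exp]
      congr 1; push_cast; ring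
    have hc4 : Real.exp (-(d:ℝ)) < 1 / 2 := by
      have : Real.exp (-(d:ℝ)) ≤ Real.exp (-1) := Real.exp_le_exp.2 (by linarith)
      have h9 := Real.exp_neg_one_lt_d9
      linarith
    calc (T'.offDiag.card : ℝ) * (1 - ε / 2) ^ K
        ≤ (2 * (y ^ d) ^ 2) * (((y ^ d) ^ 2)⁻¹ * Real.exp (-d)) := by
          rw [← hc3]
          exact mul_le_mul hc1 hc2 (pow_nonneg (by linarith) _) (by positivity)
      _ = 2 * Real.exp (-d) := by field_simp
      _ < 1 := by linarith
  have hempty : (T'.offDiag.filter fun p => ∀ i, (s p.1 (w i) ↔ s p.2 (w i))).card = 0 := by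
    have := lt_of_le_of_lt hw hlt
    have h : (T'.offDiag.filter fun p => ∀ i, (s p.1 (w i) ↔ s p.2 (w i))).card < 1 := by
      exact_mod_cast this
    omega
  rw [Finset.card_eq_zero, Finset.filter_eq_empty_iff] at hempty
  let pat : (X → ℝ) → Finset (Fin K) := fun f => Finset.univ.filter fun i => s f (w i)
  have hinj : Set.InjOn pat T' := by
    intro f hf f' hf' hff
    by_contra hne
    refine hempty (x := (f, f')) (Finset.mem_offDiag.2 ⟨hf, hf', hne⟩) fun i => ?_
    have := Finset.ext_iff.1 hff i
    simpa [pat] using this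
  have hcard := aux_sauer Λ (fun j i => g j (x (w i).1)) (fun i => thr (w i).2) (T'.image pat) (by
    intro A hA
    obtain ⟨f, hf, rfl⟩ := Finset.mem_image.1 hA
    obtain ⟨β, hβ, rfl⟩ := hT f (hT'T hf)
    refine ⟨β, hβ, fun i => ?_⟩
    simp only [pat, s, Finset.mem_filter, Finset.mem_univ, true_and]
    apply aux_trunc_lt
    · have : (0:ℝ) ≤ 2 * (((w i).2 : ℕ) : ℝ) / Q := by positivity
      simp only [thr]; linarith
    · have h1 : (((w i).2 : ℕ) : ℝ) < Q := by exact_mod_cast (w i).2.2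
      have : 2 * (((w i).2 : ℕ) : ℝ) / Q < 2 := by rw [div_lt_iff₀ hQ']; linarith
      simp only [thr]; linarith)
  rw [Finset.card_image_of_injOn hinj] at hcard
  have h10 : (T'.card : ℝ) ≤ (Real.exp 1 * K / d) ^ d :=
    (Nat.cast_le.2 hcard).trans (aux_binom K d hd hdK)
  have h11 : Real.exp 1 * K / d ≤ y := by
    refine le_trans ?_ hy2
    rw [div_le_iff₀ (by linarith)]
    have := mul_le_mul_of_nonneg_left hK2 (Real.exp_pos 1).le
    refine this.trans (le_of_eq ?_)
    ring
  have h12 : (Real.exp 1 * K / d) ^ d ≤ y ^ d := pow_le_pow_left₀ (by positivity) h11 d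
  linarith

lemma aux_cover {X : Type*} {m : ℕ} (F : Set (X → ℝ)) (ε B : ℝ) (hε0 : 0 < ε) (x : Fin m → X)
    (hB : ∀ T : Finset (X → ℝ), (∀ f ∈ T, f ∈ F) →
      (∀ f ∈ T, ∀ f' ∈ T, f ≠ f' → ε < (1 / (m : ℝ)) * ∑ i, |f (x i) - f' (x i)|) →
      (T.card : ℝ) ≤ B) :
    ∃ T : Finset (X → ℝ), (T.card : ℝ) ≤ B ∧
      ∀ f ∈ F, ∃ c ∈ T, (1 / (m : ℝ)) * ∑ i, |f (x i) - c (x i)| ≤ ε := by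
  classical
  let Good : Finset (X → ℝ) → Prop := fun T => (∀ f ∈ T, f ∈ F) ∧
      (∀ f ∈ T, ∀ f' ∈ T, f ≠ f' → ε < (1 / (m : ℝ)) * ∑ i, |f (x i) - f' (x i)|)
  let S : Set ℕ := {N | ∃ T, Good T ∧ T.card = N}
  have hne : S.Nonempty := ⟨0, ∅, ⟨by simp, by simp⟩, rfl⟩
  have hbd : BddAbove S := by
    refine ⟨⌊B⌋₊, ?_⟩
    rintro N ⟨T, hT, rfl⟩
    exact Nat.le_floor (hB T hT.1 hT.2)
  obtain ⟨T, hT, hTc⟩ := Nat.sSup_mem hne hbd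
  refine ⟨T, hB T hT.1 hT.2, fun f hf => ?_⟩
  by_contra hcon
  push Not at hcon
  have hfT : f ∉ T := by
    intro h
    have := hcon f h
    simp at this
    linarith
  have hgood : Good (insert f T) := by
    refine ⟨fun f' hf' => ?_, fun f1 h1 f2 h2 hne => ?_⟩
    · rcases Finset.mem_insert.1 hf' with rfl | h
      · exact hf
      · exact hT.1 _ h
    · rcases Finset.mem_insert.1 h1 with rfl | h1
      · rcases Finset.mem_insert.1 h2 with rfl | h2
        · exact absurd rfl hne
        · exact hcon _ h2
      · rcases Finset.mem_insert.1 h2 with rfl | h2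
        · have := hcon f1 (by assumption)
          simp_rw [abs_sub_comm (f1 _)]
          exact this
        · exact hT.2 _ h1 _ h2 hne
  have : (insert f T).card ≤ sSup S := le_csSup hbd ⟨_, hgood, rfl⟩
  rw [Finset.card_insert_of_notMem hfT, hTc] at this
  omega

lemma aux_fact (d : ℕ) : 5 ^ d ≤ 27 * d.factorial := by
  by_cases h : d ≤ 4
  · interval_cases d <;> decide
  · push Not at h
    induction d, h using Nat.le_induction with
    | base => decide
    | succ d hd ih =>
      rw [pow_succ, Nat.factorial_succ]
      nlinarith

/-- **Covering number estimate** (Lemma 5): if `n ≤ m^a` with `a ≥ 1` and `‖g_j‖_∞ ≤ 1`,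
then for every `0 < ε ≤ 1` and points `x₁, …, x_m`,
`N₁(ε, F_k, x₁^m) ≤ 3 m^{ak} ((2e/ε) log(3e/ε))^{k+1}`. -/
theorem statement9 {X : Type*} (m n k : ℕ) (hm : 1 ≤ m) (hk : 1 ≤ k)
    (a : ℝ) (ha : 1 ≤ a) (hn : (n : ℝ) ≤ (m : ℝ) ^ a)
    (g : Fin n → X → ℝ) (hg : ∀ j t, |g j t| ≤ 1)
    (ε : ℝ) (hε0 : 0 < ε) (hε1 : ε ≤ 1) (x : Fin m → X) :
    (covN ε (hypSpace g k) x : ℝ) ≤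
      3 * (m : ℝ) ^ (a * k) *
        ((2 * Real.exp 1 / ε) * Real.log (3 * Real.exp 1 / ε)) ^ (k + 1) := by
  classical
  set L := (2 * Real.exp 1 / ε) * Real.log (3 * Real.exp 1 / ε) with hL
  obtain ⟨hL9, hnum⟩ := aux_numeric ε hε0 hε1 L hL
  have hm' : (1:ℝ) ≤ m := by exact_mod_cast hm
  set d := min n k with hd
  -- a cover for every sub-dictionary of size `d`
  have hcov : ∀ Λ : Finset (Fin n), Λ.card = d → ∃ T : Finset (X → ℝ),
      (T.card : ℝ) ≤ (5 * L) ^ d ∧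
      ∀ f ∈ auxSpan g Λ, ∃ c ∈ T, (1 / (m : ℝ)) * ∑ i, |f (x i) - c (x i)| ≤ ε := by
    intro Λ hΛ
    by_cases h0 : d = 0
    · refine ⟨{fun t => trunc 0}, by simp [h0], ?_⟩
      rintro f ⟨β, hβ, rfl⟩
      have hΛ0 : Λ = ∅ := Finset.card_eq_zero.1 (hΛ.trans h0)
      have : ∀ j, β j = 0 := fun j => hβ j (by simp [hΛ0])
      refine ⟨_, Finset.mem_singleton_self _, ?_⟩
      simp [this, hε0.le]
    · refine aux_cover (auxSpan g Λ) ε _ hε0 x fun T hT hsep => ?_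
      rw [← hΛ]
      exact aux_packing m n hm g Λ (by omega) ε hε0 hε1 x (5 * L) (by linarith) hnum T hT hsep
  choose! C hC1 hC2 using hcov
  let U : Finset (X → ℝ) := (Finset.powersetCard d (Finset.univ : Finset (Fin n))).biUnion C
  have hU : (U.card : ℝ) ≤ (n.choose d : ℝ) * (5 * L) ^ d := by
    have h1 : (U.card : ℝ) ≤
        ((∑ Λ ∈ Finset.powersetCard d (Finset.univ : Finset (Fin n)), (C Λ).card : ℕ) : ℝ) :=
      Nat.cast_le.2 Finset.card_biUnion_le
    refine h1.trans ?_
    push_cast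
    refine (Finset.sum_le_sum fun Λ hΛ => hC1 Λ (Finset.mem_powersetCard.1 hΛ).2).trans ?_
    simp [Finset.card_powersetCard]
  have hcovU : covN ε (hypSpace g k) x ≤ U.card := by
    refine Nat.sInf_le ?_
    refine ⟨fun j => (U.equivFin.symm j : X → ℝ), fun f hf => ?_⟩
    obtain ⟨Λ, hΛ, β, hβ, hfe⟩ := hf
    have hΛd : Λ.card ≤ d := le_min (by simpa using Finset.card_le_univ Λ) hΛ
    obtain ⟨Λ', hsub, hcard⟩ := Finset.exists_superset_card_eq hΛd
      (by simp [hd])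
    obtain ⟨c, hc, hdist⟩ := hC2 Λ' hcard f ⟨β, fun j hj => hβ j fun h => hj (hsub h), hfe⟩
    have hcU : c ∈ U := Finset.mem_biUnion.2
      ⟨Λ', Finset.mem_powersetCard.2 ⟨Finset.subset_univ _, hcard⟩, hc⟩
    exact ⟨U.equivFin ⟨c, hcU⟩, by simpa using hdist⟩
  have hch : (n.choose d : ℝ) ≤ (n:ℝ) ^ d / d.factorial := Nat.choose_le_pow_div d n
  have hfac : (5:ℝ) ^ d ≤ 27 * d.factorial := by exact_mod_cast aux_fact d
  have hfpos : (0:ℝ) < d.factorial := by exact_mod_cast d.factorial_pos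
  have hnd : (n:ℝ) ^ d ≤ (m:ℝ) ^ (a * k) := by
    calc (n:ℝ) ^ d ≤ ((m:ℝ) ^ a) ^ d := by gcongr
      _ = (m:ℝ) ^ (a * d) := by rw [Real.rpow_mul (by positivity), Real.rpow_natCast]
      _ ≤ (m:ℝ) ^ (a * k) := by
        apply Real.rpow_le_rpow_of_exponent_le hm'
        have : (d:ℝ) ≤ k := by exact_mod_cast min_le_right n k
        exact mul_le_mul_of_nonneg_left this (by linarith)
  have hLpos : 0 < L := by linarith
  calc (covN ε (hypSpace g k) x : ℝ) ≤ U.card := by exact_mod_cast hcovU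
    _ ≤ (n.choose d : ℝ) * (5 * L) ^ d := hU
    _ ≤ ((n:ℝ) ^ d / d.factorial) * (27 * d.factorial * L ^ d) := by
        rw [mul_pow]
        gcongr
    _ = 3 * (n:ℝ) ^ d * (L ^ d * 9) := by field_simp; ring
    _ ≤ 3 * (m:ℝ) ^ (a * k) * (L ^ d * L) := by gcongr
    _ = 3 * (m:ℝ) ^ (a * k) * L ^ (d + 1) := by rw [pow_succ]
    _ ≤ 3 * (m:ℝ) ^ (a * k) * L ^ (k + 1) := by
        have : d ≤ k := min_le_right n k
        gcongr
        linarith
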